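/- arXiv:2510.04583 — 2 statements merged into one kernel-verified Lean document; each statement's English description precedes it below -/
import Mathlib

section
/- Let d ≥ 1, K ≥ 1. Let x_t ∈ ℝ^d, let π_1,…,π_K ≥ 0 with π_1+⋯+π_K = 1, let μ_1,…,μ_K ∈ ℝ^d and let Σ_1,…,Σ_K be symmetric positive definite d×d real matrices. Let a, b ∈ (0,1), set ᾱ := a·b, and let σ > 0 satisfy σ² ≤ 1 − b. Define λ := √(1 − b − σ²), γ := λ − √(1−ᾱ)/√a, and for ε ∈ ℝ^d define μ̃(ε) := √b · (x_t − √(1−ᾱ) ε)/√ᾱ + λ ε. Then for every x' ∈ ℝ^d, ∫_{ℝ^d} φ_d(x'; μ̃(ε), σ² I) · ( Σ_{k=1}^K π_k φ_d(ε; μ_k, Σ_k) ) dε = Σ_{k=1}^K π_k φ_d(x'; √b · (x_t − √(1−ᾱ) μ_k)/√ᾱ + λ μ_k, γ² Σ_k + σ² I). -/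
open MeasureTheory Matrix Real

/-- Density of the multivariate normal distribution `N(μ, S)` on `ℝ^d`. -/
noncomputable def mvnPdf {d : ℕ} (μ : Fin d → ℝ) (S : Matrix (Fin d) (Fin d) ℝ)
    (x : Fin d → ℝ) : ℝ :=
  (Real.sqrt ((2 * Real.pi) ^ d * S.det))⁻¹ *
    Real.exp (-(1 / 2) * ((x - μ) ⬝ᵥ (S⁻¹ *ᵥ (x - μ))))

/-- Density of the centered normal distribution on `ℝ` with variance `v`. -/
noncomputable def centeredPdf (v x : ℝ) : ℝ :=
  (√(2 * π * v))⁻¹ * Real.exp (-(1 / 2) * (x ^ 2 / v))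

/-- Smoothing a centered normal density by a normal kernel with variance `s`. -/
theorem integral_centeredPdf_mul {s v : ℝ} (hs : 0 < s) (hv : 0 < v) (γ z : ℝ) :
    ∫ y, centeredPdf s (z - γ * y) * centeredPdf v y = centeredPdf (γ ^ 2 * v + s) z := by
  set T := γ ^ 2 * v + s with hT
  have hT0 : 0 < T := by positivity
  have h (y : ℝ) : centeredPdf s (z - γ * y) * centeredPdf v y =
      ((√(2 * π * s))⁻¹ * (√(2 * π * v))⁻¹ * Real.exp (-(1 / 2) * (z ^ 2 / T))) *
        Real.exp (-(T / (2 * s * v)) * (y - γ * v * z / T) ^ 2) := by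
    unfold centeredPdf
    rw [mul_mul_mul_comm, ← Real.exp_add, mul_assoc _ (Real.exp _), ← Real.exp_add]
    congr 2
    field_simp
    rw [hT]
    ring
  simp_rw [h]
  rw [integral_const_mul,
    integral_sub_right_eq_self (fun y => Real.exp (-(T / (2 * s * v)) * y ^ 2)), integral_gaussian,
    centeredPdf, mul_right_comm]
  congr 1
  rw [← Real.sqrt_inv, ← Real.sqrt_inv, ← Real.sqrt_inv, ← Real.sqrt_mul (by positivity),
    ← Real.sqrt_mul (by positivity)]
  congr 1
  field_simp

/-- A normal density factors into one-dimensional ones in orthogonal coordinates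
diagonalizing the covariance matrix. -/
theorem mvnPdf_conj_diagonal {d : ℕ} {U : Matrix (Fin d) (Fin d) ℝ} (hU : Uᵀ * U = 1)
    {v : Fin d → ℝ} (hv : ∀ i, 0 < v i) (m x : Fin d → ℝ) :
    mvnPdf m (U * diagonal v * Uᵀ) x = ∏ i, centeredPdf (v i) ((Uᵀ *ᵥ (x - m)) i) := by
  have hU' : U * Uᵀ = 1 := mul_eq_one_comm.mp hU
  have hinv : (U * diagonal v * Uᵀ)⁻¹ = U * diagonal (fun i => (v i)⁻¹) * Uᵀ := by
    apply inv_eq_right_inv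
    have hd : diagonal v * diagonal (fun i => (v i)⁻¹) = 1 := by
      rw [diagonal_mul_diagonal, ← diagonal_one]
      exact congrArg _ (funext fun i => mul_inv_cancel₀ (hv i).ne')
    calc _ = U * (diagonal v * (Uᵀ * U) * diagonal (fun i => (v i)⁻¹)) * Uᵀ := by
          simp only [Matrix.mul_assoc]
      _ = 1 := by rw [hU, Matrix.mul_one, hd, Matrix.mul_one, hU']
  have hdet : (U * diagonal v * Uᵀ).det = ∏ i, v i := by
    rw [det_mul_comm, ← Matrix.mul_assoc, hU, Matrix.one_mul, det_diagonal]
  have hquad : (x - m) ⬝ᵥ ((U * diagonal v * Uᵀ)⁻¹ *ᵥ (x - m)) =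
      ∑ i, (Uᵀ *ᵥ (x - m)) i ^ 2 / v i := by
    rw [hinv, Matrix.mul_assoc, ← mulVec_mulVec, dotProduct_mulVec, ← mulVec_transpose,
      ← mulVec_mulVec, dotProduct]
    refine Finset.sum_congr rfl fun i _ => ?_
    rw [mulVec_diagonal]
    ring
  unfold mvnPdf centeredPdf
  rw [hdet, hquad, Finset.prod_mul_distrib, ← Real.exp_sum, ← Finset.mul_sum,
    Finset.prod_inv_distrib, ← Real.sqrt_prod _ fun i _ => by have := hv i; positivity,
    Finset.prod_mul_distrib]
  simp

theorem Matrix.measurePreserving_mulVec_of_orthogonal {ι : Type*} [Fintype ι] [DecidableEq ι]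
    {U : Matrix ι ι ℝ} (hU : Uᵀ * U = 1) :
    MeasurePreserving (fun y : ι → ℝ => U *ᵥ y) volume volume := by
  have hdet : U.det * U.det = 1 := by
    simpa [det_mul] using congrArg Matrix.det hU
  have habs : |U.det⁻¹| = 1 := by
    rcases mul_self_eq_one_iff.mp hdet with h | h <;> simp [h]
  refine ⟨by fun_prop, ?_⟩
  have := Real.map_matrix_volume_pi_eq_smul_volume_pi (M := U) (by rintro h; simp [h] at hdet)
  rwa [habs, ENNReal.ofReal_one, one_smul] at this

theorem Matrix.integral_comp_mulVec_of_orthogonal {ι : Type*} [Fintype ι] [DecidableEq ι]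
    {U : Matrix ι ι ℝ} (hU : Uᵀ * U = 1) (f : (ι → ℝ) → ℝ) :
    ∫ y, f (U *ᵥ y) = ∫ y, f y := by
  refine (measurePreserving_mulVec_of_orthogonal hU).integral_comp ?_ f
  refine Continuous.measurableEmbedding (by fun_prop) fun y z h => ?_
  simpa [mulVec_mulVec, hU] using congrArg (Uᵀ *ᵥ ·) h

theorem Matrix.PosDef.exists_orthogonal_conj_diagonal {ι : Type*} [Fintype ι] [DecidableEq ι]
    {S : Matrix ι ι ℝ} (hS : S.PosDef) :
    ∃ (U : Matrix ι ι ℝ) (v : ι → ℝ), Uᵀ * U = 1 ∧ (∀ i, 0 < v i) ∧ S = U * diagonal v * Uᵀ := by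
  refine ⟨hS.1.eigenvectorUnitary, hS.1.eigenvalues, ?_, hS.eigenvalues_pos, ?_⟩
  · exact mem_unitaryGroup_iff'.mp hS.1.eigenvectorUnitary.2
  · exact hS.1.spectral_theorem

/-- A linear-Gaussian kernel with isotropic noise maps a normal density to a normal density. -/
theorem integral_mvnPdf_mul_mvnPdf {d : ℕ} {S : Matrix (Fin d) (Fin d) ℝ} (hS : S.PosDef)
    {s : ℝ} (hs : 0 < s) (γ : ℝ) (c m x : Fin d → ℝ) :
    ∫ ε, mvnPdf (c + γ • ε) (s • (1 : Matrix (Fin d) (Fin d) ℝ)) x * mvnPdf m S ε =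
      mvnPdf (c + γ • m) (γ ^ 2 • S + s • (1 : Matrix (Fin d) (Fin d) ℝ)) x := by
  obtain ⟨U, v, hU, hv, rfl⟩ := hS.exists_orthogonal_conj_diagonal
  have hU' : U * Uᵀ = 1 := mul_eq_one_comm.mp hU
  have hiso : s • (1 : Matrix (Fin d) (Fin d) ℝ) = U * diagonal (fun _ => s) * Uᵀ := by
    rw [← smul_one_eq_diagonal, Matrix.mul_smul, Matrix.smul_mul, Matrix.mul_one, hU']
  have hcov : γ ^ 2 • (U * diagonal v * Uᵀ) + s • (1 : Matrix (Fin d) (Fin d) ℝ) =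
      U * diagonal (fun i => γ ^ 2 * v i + s) * Uᵀ := by
    rw [hiso, ← Matrix.smul_mul, ← Matrix.mul_smul, ← Matrix.add_mul, ← Matrix.mul_add,
      ← diagonal_smul, diagonal_add]
    rfl
  rw [hcov, hiso, mvnPdf_conj_diagonal hU fun i => by have := hv i; positivity]
  simp_rw [mvnPdf_conj_diagonal hU hv, mvnPdf_conj_diagonal hU fun _ => hs]
  rw [← integral_add_right_eq_self _ m, ← integral_comp_mulVec_of_orthogonal hU]
  have h (y : Fin d → ℝ) (i : Fin d) : (Uᵀ *ᵥ (x - (c + γ • (U *ᵥ y + m)))) i =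
      (Uᵀ *ᵥ (x - (c + γ • m))) i - γ * y i := by
    have : x - (c + γ • (U *ᵥ y + m)) = (x - (c + γ • m)) - γ • (U *ᵥ y) := by
      rw [smul_add]; abel
    rw [this, mulVec_sub, mulVec_smul, mulVec_mulVec, hU, one_mulVec]
    rfl
  simp_rw [h, add_sub_cancel_right, mulVec_mulVec, hU, one_mulVec, ← Finset.prod_mul_distrib]
  rw [integral_fintype_prod_volume_eq_prod
    (fun i t => centeredPdf s ((Uᵀ *ᵥ (x - (c + γ • m))) i - γ * t) * centeredPdf (v i) t)]
  exact Finset.prod_congr rfl fun i _ => integral_centeredPdf_mul hs (hv i) _ _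

theorem mvnPdf_pos {d : ℕ} {S : Matrix (Fin d) (Fin d) ℝ} (hS : S.PosDef) (m x : Fin d → ℝ) :
    0 < mvnPdf m S x := by
  have := hS.det_pos
  unfold mvnPdf
  positivity

theorem integrable_mvnPdf_mul_mvnPdf {d : ℕ} {S : Matrix (Fin d) (Fin d) ℝ} (hS : S.PosDef)
    {s : ℝ} (hs : 0 < s) (γ : ℝ) (c m x : Fin d → ℝ) :
    Integrable fun ε =>
      mvnPdf (c + γ • ε) (s • (1 : Matrix (Fin d) (Fin d) ℝ)) x * mvnPdf m S ε := by
  refine Integrable.of_integral_ne_zero ?_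
  rw [integral_mvnPdf_mul_mvnPdf hS hs]
  exact (mvnPdf_pos
    (PosDef.posSemidef_add (hS.posSemidef.smul (sq_nonneg γ)) (PosDef.one.smul hs)) _ _).ne'

/-- Theorem 1 (closed-form reverse transition for a Gaussian-mixture noise model). -/
theorem stmt_0 (d K : ℕ) (hd : 1 ≤ d) (hK : 1 ≤ K)
    (xt : Fin d → ℝ)
    (w : Fin K → ℝ) (hw : ∀ k, 0 ≤ w k) (hw1 : ∑ k, w k = 1)
    (μ : Fin K → Fin d → ℝ)
    (S : Fin K → Matrix (Fin d) (Fin d) ℝ) (hS : ∀ k, (S k).PosDef)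
    (a b : ℝ) (ha : a ∈ Set.Ioo (0 : ℝ) 1) (hb : b ∈ Set.Ioo (0 : ℝ) 1)
    (abar : ℝ) (habar : abar = a * b)
    (σ : ℝ) (hσ : 0 < σ) (hσb : σ ^ 2 ≤ 1 - b)
    (lam γ : ℝ)
    (hlam : lam = Real.sqrt (1 - b - σ ^ 2))
    (hγ : γ = lam - Real.sqrt (1 - abar) / Real.sqrt a) :
    ∀ x' : Fin d → ℝ,
      (∫ ε : Fin d → ℝ,
          mvnPdf ((Real.sqrt b / Real.sqrt abar) • (xt - Real.sqrt (1 - abar) • ε)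
              + lam • ε)
            (σ ^ 2 • (1 : Matrix (Fin d) (Fin d) ℝ)) x'
          * ∑ k, w k * mvnPdf (μ k) (S k) ε)
      = ∑ k, w k *
          mvnPdf ((Real.sqrt b / Real.sqrt abar) • (xt - Real.sqrt (1 - abar) • μ k)
              + lam • μ k)
            (γ ^ 2 • S k + σ ^ 2 • (1 : Matrix (Fin d) (Fin d) ℝ)) x' := by
  intro x'
  obtain ⟨ha0, -⟩ := ha
  obtain ⟨hb0, -⟩ := hb
  have hcoef : √b / √abar * √(1 - abar) = √(1 - abar) / √a := by
    have := Real.sqrt_pos.mpr ha0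
    have := Real.sqrt_pos.mpr hb0
    rw [habar, Real.sqrt_mul ha0.le]
    field_simp
  have hmean (ε : Fin d → ℝ) : (√b / √abar) • (xt - √(1 - abar) • ε) + lam • ε =
      (√b / √abar) • xt + γ • ε := by
    rw [smul_sub, smul_smul, hcoef, hγ, sub_smul]
    abel
  have hs : 0 < σ ^ 2 := by positivity
  simp_rw [hmean, Finset.mul_sum, mul_left_comm _ (w _)]
  rw [integral_finsetSum _ fun k _ =>
    (integrable_mvnPdf_mul_mvnPdf (hS k) hs γ _ (μ k) x').const_mul (w k)]
  simp_rw [integral_const_mul, integral_mvnPdf_mul_mvnPdf (hS _) hs]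
end

section
/- Let d ≥ 1, μ ∈ ℝ^d, γ > 0, and let Σ be a symmetric positive definite d×d real matrix. Then ∫_{ℝ^d} ∫_{ℝ^d} exp(−‖x−x'‖²/γ²) · φ_d(x; μ, Σ) · φ_d(x'; μ, Σ) dx dx' = det(I + (4/γ²)Σ)^{−1/2}. -/
open MeasureTheory Matrix Real

theorem exists_orthogonal_diagonalization {d : ℕ} {S : Matrix (Fin d) (Fin d) ℝ}
    (hS : S.PosDef) :
    ∃ (U : Matrix (Fin d) (Fin d) ℝ) (l : Fin d → ℝ),
      Uᵀ * U = 1 ∧ U * Uᵀ = 1 ∧ (∀ i, 0 < l i) ∧ S = U * diagonal l * Uᵀ := by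
  have hU := hS.1.eigenvectorUnitary.2
  refine ⟨hS.1.eigenvectorUnitary, hS.1.eigenvalues, ?_, ?_, hS.eigenvalues_pos, ?_⟩
  · simpa [star_eq_conjTranspose] using (Unitary.mem_iff.1 hU).1
  · simpa [star_eq_conjTranspose] using (Unitary.mem_iff.1 hU).2
  · conv_lhs => rw [hS.1.spectral_theorem]
    rw [Unitary.conjStarAlgAut_apply]
    rfl

theorem integral_comp_add_orthogonal_mulVec {d : ℕ} {U : Matrix (Fin d) (Fin d) ℝ}
    (hU : Uᵀ * U = 1) (μ : Fin d → ℝ) (f : (Fin d → ℝ) → ℝ) :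
    ∫ y, f (μ + U *ᵥ y) = ∫ x, f x := by
  have hdet : U.det * U.det = 1 := by simpa using congrArg Matrix.det hU
  have habs : |U.det| = 1 := by
    rcases mul_self_eq_one_iff.1 hdet with h | h <;> simp [h]
  have hcont : Continuous (toLin' U) := LinearMap.continuous_on_pi _
  have hinj : Function.Injective (toLin' U) := by
    refine Function.LeftInverse.injective (g := fun y ↦ Uᵀ *ᵥ y) fun y ↦ ?_
    simp [hU]
  have hmap : MeasurePreserving (toLin' U) volume volume := by
    refine ⟨hcont.measurable, ?_⟩
    rw [Real.map_matrix_volume_pi_eq_smul_volume_pi (left_ne_zero_of_mul_eq_one hdet)]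
    simp [abs_inv, habs]
  calc ∫ y, f (μ + U *ᵥ y) = ∫ x, f (μ + x) :=
        hmap.integral_comp (hcont.measurableEmbedding hinj) fun x ↦ f (μ + x)
    _ = ∫ x, f x := integral_add_left_eq_self f μ

theorem mvnPdf_add_orthogonal_mulVec {d : ℕ} {U : Matrix (Fin d) (Fin d) ℝ}
    {l : Fin d → ℝ} (hU : Uᵀ * U = 1) (hU' : U * Uᵀ = 1) (hl : ∀ i, 0 < l i)
    (μ y : Fin d → ℝ) :
    mvnPdf μ (U * diagonal l * Uᵀ) (μ + U *ᵥ y) =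
      ∏ i, (√(2 * π * l i))⁻¹ * Real.exp (-(y i ^ 2 / (2 * l i))) := by
  have hdet : (U * diagonal l * Uᵀ).det = ∏ i, l i := by
    have h : U.det * U.det = 1 := by simpa using congrArg Matrix.det hU
    rw [det_mul, det_mul, det_transpose, det_diagonal, mul_right_comm, h, one_mul]
  have hinv : (U * diagonal l * Uᵀ)⁻¹ = U * diagonal (fun i ↦ (l i)⁻¹) * Uᵀ := by
    refine inv_eq_right_inv ?_
    have hdiag : diagonal l * diagonal (fun i ↦ (l i)⁻¹) = 1 := by
      rw [diagonal_mul_diagonal, ← diagonal_one]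
      exact congrArg diagonal (funext fun i ↦ mul_inv_cancel₀ (hl i).ne')
    calc U * diagonal l * Uᵀ * (U * diagonal (fun i ↦ (l i)⁻¹) * Uᵀ)
        = U * diagonal l * (Uᵀ * U) * diagonal (fun i ↦ (l i)⁻¹) * Uᵀ := by
          simp only [Matrix.mul_assoc]
      _ = U * (diagonal l * diagonal (fun i ↦ (l i)⁻¹)) * Uᵀ := by
          simp only [hU, Matrix.mul_one, Matrix.mul_assoc]
      _ = 1 := by rw [hdiag, Matrix.mul_one, hU']
  have hquad : (U *ᵥ y) ⬝ᵥ ((U * diagonal (fun i ↦ (l i)⁻¹) * Uᵀ) *ᵥ (U *ᵥ y)) =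
      ∑ i, y i ^ 2 / l i := by
    rw [mulVec_mulVec, Matrix.mul_assoc, hU, Matrix.mul_one, ← mulVec_mulVec,
      dotProduct_mulVec, vecMul_mulVec, hU, vecMul_one]
    refine Finset.sum_congr rfl fun i _ ↦ ?_
    rw [mulVec_diagonal]
    ring
  rw [mvnPdf, hdet, hinv, add_sub_cancel_left, hquad, Finset.prod_mul_distrib,
    Finset.prod_inv_distrib, ← Real.exp_sum, ← Real.sqrt_prod _ fun i _ ↦ by
      have := hl i; positivity]
  congr 2
  · simp [Finset.prod_mul_distrib]
  · rw [Finset.mul_sum]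
    refine Finset.sum_congr rfl fun i _ ↦ ?_
    have := (hl i).ne'
    field_simp

theorem integral_exp_neg_mul_sub_sq_mul_exp_neg_mul_sq {b : ℝ} (hb : 0 ≤ b) {c : ℝ}
    (hc : 0 < c) :
    ∫ y' : ℝ, ∫ y : ℝ, Real.exp (-(b * (y - y') ^ 2) - c * y ^ 2 - c * y' ^ 2) =
      π / √(c * (c + 2 * b)) := by
  have hbc : 0 < b + c := by positivity
  have hinner (y' : ℝ) :
      ∫ y : ℝ, Real.exp (-(b * (y - y') ^ 2) - c * y ^ 2 - c * y' ^ 2) =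
        √(π / (b + c)) * Real.exp (-(c * (c + 2 * b) / (b + c)) * y' ^ 2) := by
    rw [← integral_gaussian,
      ← integral_sub_right_eq_self (fun y : ℝ ↦ Real.exp (-(b + c) * y ^ 2)) (b * y' / (b + c)),
      ← integral_mul_const]
    refine integral_congr_ae (.of_forall fun y ↦ ?_)
    simp only
    rw [← Real.exp_add]
    congr 1
    field_simp
    ring
  simp_rw [hinner]
  rw [integral_const_mul, integral_gaussian, ← Real.sqrt_mul (by positivity)]
  have : π / (b + c) * (π / (c * (c + 2 * b) / (b + c))) = π ^ 2 / (c * (c + 2 * b)) := by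
    field_simp
  rw [this, Real.sqrt_div (by positivity), Real.sqrt_sq pi_nonneg]

theorem integral_gaussianKernel_gaussian {γ l : ℝ} (hγ : 0 < γ) (hl : 0 < l) :
    ∫ y' : ℝ, ∫ y : ℝ, Real.exp (-(y - y') ^ 2 / γ ^ 2) *
        ((√(2 * π * l))⁻¹ * Real.exp (-(y ^ 2 / (2 * l)))) *
        ((√(2 * π * l))⁻¹ * Real.exp (-(y' ^ 2 / (2 * l)))) =
      (√(1 + 4 / γ ^ 2 * l))⁻¹ := by
  have hfun (y' y : ℝ) : Real.exp (-(y - y') ^ 2 / γ ^ 2) *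
        ((√(2 * π * l))⁻¹ * Real.exp (-(y ^ 2 / (2 * l)))) *
        ((√(2 * π * l))⁻¹ * Real.exp (-(y' ^ 2 / (2 * l)))) =
      (2 * π * l)⁻¹ * Real.exp (-((γ ^ 2)⁻¹ * (y - y') ^ 2) - (2 * l)⁻¹ * y ^ 2 -
        (2 * l)⁻¹ * y' ^ 2) := by
    have hs : (√(2 * π * l))⁻¹ * (√(2 * π * l))⁻¹ = (2 * π * l)⁻¹ := by
      rw [← mul_inv, Real.mul_self_sqrt (by positivity)]
    rw [← hs, sub_eq_add_neg _ ((2 * l)⁻¹ * y' ^ 2), sub_eq_add_neg _ ((2 * l)⁻¹ * y ^ 2),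
      Real.exp_add, Real.exp_add]
    ring_nf
  simp_rw [hfun, integral_const_mul]
  rw [integral_exp_neg_mul_sub_sq_mul_exp_neg_mul_sq (by positivity) (by positivity)]
  have : (2 * l)⁻¹ * ((2 * l)⁻¹ + 2 * (γ ^ 2)⁻¹) = (1 + 4 / γ ^ 2 * l) / (2 * l) ^ 2 := by
    field_simp
    ring
  rw [this, Real.sqrt_div (by positivity), Real.sqrt_sq (by positivity)]
  field_simp

theorem det_one_add_smul_orthogonal_conj {d : ℕ} {U : Matrix (Fin d) (Fin d) ℝ}
    (hU' : U * Uᵀ = 1) (l : Fin d → ℝ) (c : ℝ) :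
    (1 + c • (U * diagonal l * Uᵀ)).det = ∏ i, (1 + c * l i) := by
  have h : 1 + c • (U * diagonal l * Uᵀ) = U * diagonal (fun i ↦ 1 + c * l i) * Uᵀ := by
    have hd : diagonal (fun i ↦ 1 + c * l i) = 1 + c • diagonal l := by
      rw [← diagonal_one, ← diagonal_smul, diagonal_add]
      rfl
    rw [hd, Matrix.mul_add, Matrix.add_mul, Matrix.mul_one, hU', Matrix.mul_smul,
      Matrix.smul_mul]
  have hdet : U.det * U.det = 1 := by simpa using congrArg Matrix.det hU'
  rw [h, det_mul, det_mul, det_transpose, det_diagonal, mul_right_comm, hdet, one_mul]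

theorem exp_neg_dotProduct_orthogonal_mulVec {d : ℕ} {U : Matrix (Fin d) (Fin d) ℝ}
    (hU : Uᵀ * U = 1) (μ y y' : Fin d → ℝ) (g : ℝ) :
    Real.exp (-((μ + U *ᵥ y - (μ + U *ᵥ y')) ⬝ᵥ (μ + U *ᵥ y - (μ + U *ᵥ y'))) / g) =
      ∏ i, Real.exp (-(y i - y' i) ^ 2 / g) := by
  rw [add_sub_add_left_eq_sub, ← mulVec_sub, dotProduct_mulVec, vecMul_mulVec, hU,
    vecMul_one, ← Real.exp_sum, dotProduct, ← Finset.sum_neg_distrib, Finset.sum_div]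
  simp [sq]

/-- `E_{X,X' i.i.d. ~ N(μ,S)}[exp(−‖X−X'‖²/γ²)] = det(I + (4/γ²)S)^{−1/2}`.
Here `‖v‖² = v ⬝ᵥ v` is the squared Euclidean norm. -/
theorem stmt_7 (d : ℕ) (hd : 1 ≤ d) (μ : Fin d → ℝ) (γ : ℝ) (hγ : 0 < γ)
    (S : Matrix (Fin d) (Fin d) ℝ) (hS : S.PosDef) :
    (∫ x' : Fin d → ℝ, ∫ x : Fin d → ℝ,
        Real.exp (-((x - x') ⬝ᵥ (x - x')) / γ ^ 2) * mvnPdf μ S x * mvnPdf μ S x')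
      = (Real.sqrt ((1 + (4 / γ ^ 2) • S : Matrix (Fin d) (Fin d) ℝ).det))⁻¹ := by
  obtain ⟨U, l, hU, hU', hl, rfl⟩ := exists_orthogonal_diagonalization hS
  rw [← integral_comp_add_orthogonal_mulVec hU μ]
  simp_rw [← integral_comp_add_orthogonal_mulVec hU μ (fun x ↦ Real.exp _ * mvnPdf μ _ x * _),
    exp_neg_dotProduct_orthogonal_mulVec hU, mvnPdf_add_orthogonal_mulVec hU hU' hl,
    ← Finset.prod_mul_distrib]
  have hinner (y' : Fin d → ℝ) := integral_fintype_prod_volume_eq_prod (𝕜 := ℝ)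
    fun (i : Fin d) (y : ℝ) ↦ Real.exp (-(y - y' i) ^ 2 / γ ^ 2) *
      ((√(2 * π * l i))⁻¹ * Real.exp (-(y ^ 2 / (2 * l i)))) *
      ((√(2 * π * l i))⁻¹ * Real.exp (-(y' i ^ 2 / (2 * l i))))
  simp_rw [hinner]
  rw [integral_fintype_prod_volume_eq_prod (𝕜 := ℝ) fun (i : Fin d) (y' : ℝ) ↦
    ∫ y : ℝ, Real.exp (-(y - y') ^ 2 / γ ^ 2) *
      ((√(2 * π * l i))⁻¹ * Real.exp (-(y ^ 2 / (2 * l i)))) *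
      ((√(2 * π * l i))⁻¹ * Real.exp (-(y' ^ 2 / (2 * l i))))]
  simp_rw [integral_gaussianKernel_gaussian hγ (hl _)]
  rw [det_one_add_smul_orthogonal_conj hU', Finset.prod_inv_distrib,
    Real.sqrt_prod _ fun i _ ↦ by have := hl i; positivity]
end
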